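/- arXiv:2102.05223 — 2 statements merged into one kernel-verified Lean document; each statement's English description precedes it below -/
import Mathlib

section
/- Fix p ∈ ℕ, a symmetric positive semidefinite p×p real matrix Σ, and a diagonal p×p real matrix D = diag(s) such that the 2p×2p block matrix G = [[Σ, Σ−D], [Σ−D, Σ]] is positive semidefinite. Let ν be the centered multivariate Gaussian measure on ℝ^{2p} with covariance matrix G. Then for every subset S ⊆ {1,…,p}, ν is invariant under the swap map swap_S (viewed as a linear map on ℝ^{2p} = ℝ^p × ℝ^p): (swap_S)_*ν = ν. In particular, if (X, X̃) ~ N(0, G), then X̃ is a valid model-X knockoff copy of X with respect to the exchangeability condition of Definition 1(1). -/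
open MeasureTheory ProbabilityTheory Matrix

/-- `ν` is the centered multivariate Gaussian measure with covariance matrix `G`,
characterized (Cramér–Wold) by all of its one-dimensional linear marginals:
for every vector `a`, the law of `x ↦ ∑ i, a i * x i` is `N(0, aᵀ G a)`. -/
def IsCenteredGaussianWithCov {n : Type*} [Fintype n]
    (ν : Measure (n → ℝ)) (G : Matrix n n ℝ) : Prop :=
  IsProbabilityMeasure ν ∧
    ∀ a : n → ℝ,
      ν.map (fun x => ∑ i, a i * x i) =
        gaussianReal 0 (Real.toNNReal (a ⬝ᵥ G *ᵥ a))

/-- The swap map on `ℝ^{2p}` (indexed by `Fin p ⊕ Fin p`, the first summand for the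
original features and the second for the knockoffs): exchanges coordinates `j` and
`p + j` for every `j ∈ S`, fixing all other coordinates. -/
def sumSwap {p : ℕ} (S : Finset (Fin p)) : (Fin p ⊕ Fin p → ℝ) → (Fin p ⊕ Fin p → ℝ) :=
  fun x i => match i with
    | Sum.inl j => if j ∈ S then x (Sum.inr j) else x (Sum.inl j)
    | Sum.inr j => if j ∈ S then x (Sum.inl j) else x (Sum.inr j)

/-- A finite measure on `n → ℝ` is determined by the laws of all linear combinations of the
coordinates. -/
theorem ext_of_map_sum_mul {n : Type*} [Fintype n] {μ ν : Measure (n → ℝ)}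
    [IsFiniteMeasure μ] [IsFiniteMeasure ν]
    (h : ∀ a : n → ℝ, μ.map (fun x => ∑ i, a i * x i) = ν.map (fun x => ∑ i, a i * x i)) :
    μ = ν := by
  classical
  refine Measure.ext_of_charFunDual (funext fun L => ?_)
  have hL : (L : (n → ℝ) → ℝ) = fun x => ∑ i, L (Pi.single i 1) * x i := by
    funext x
    have hx : x = ∑ i, x i • (Pi.single i 1 : n → ℝ) := pi_eq_sum_univ' x
    conv_lhs => rw [hx]
    simp [mul_comm]
  rw [charFunDual_eq_charFun_map_one, charFunDual_eq_charFun_map_one, hL, h]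

/-- Relabelling the coordinates by a permutation that preserves the covariance matrix preserves
a centered Gaussian measure. -/
theorem IsCenteredGaussianWithCov.map_comp_perm {n : Type*} [Fintype n]
    {ν : Measure (n → ℝ)} {G : Matrix n n ℝ} (hν : IsCenteredGaussianWithCov ν G)
    (σ : Equiv.Perm n) (hσ : G.submatrix σ σ = G) :
    ν.map (fun x => x ∘ σ) = ν := by
  obtain ⟨hprob, hlaw⟩ := hν
  have hmeas : Measurable fun x : n → ℝ => x ∘ σ :=
    measurable_pi_lambda _ fun i => measurable_pi_apply (σ i)
  have := Measure.isProbabilityMeasure_map (μ := ν) hmeas.aemeasurable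
  refine ext_of_map_sum_mul fun a => ?_
  rw [Measure.map_map (by fun_prop) hmeas]
  have hcomp : (fun x : n → ℝ => ∑ i, a i * x i) ∘ (fun x => x ∘ σ) =
      fun x => ∑ i, (a ∘ σ.symm) i * x i := by
    funext x
    simpa using Equiv.sum_comp σ fun i => a (σ.symm i) * x i
  rw [hcomp, hlaw, hlaw]
  congr 2
  nth_rw 2 [← hσ]
  rw [submatrix_mulVec_equiv, comp_equiv_symm_dotProduct]

/-- The permutation of the coordinates of `ℝ^{2p}` underlying `sumSwap S`. -/
def sumSwapPerm {p : ℕ} (S : Finset (Fin p)) : Equiv.Perm (Fin p ⊕ Fin p) :=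
  Function.Involutive.toPerm
    (Sum.elim (fun j => if j ∈ S then Sum.inr j else Sum.inl j)
      (fun j => if j ∈ S then Sum.inl j else Sum.inr j))
    (by rintro (j | j) <;> by_cases hj : j ∈ S <;> simp [hj])

theorem sumSwapPerm_inl {p : ℕ} (S : Finset (Fin p)) (j : Fin p) :
    sumSwapPerm S (Sum.inl j) = if j ∈ S then Sum.inr j else Sum.inl j := rfl

theorem sumSwapPerm_inr {p : ℕ} (S : Finset (Fin p)) (j : Fin p) :
    sumSwapPerm S (Sum.inr j) = if j ∈ S then Sum.inl j else Sum.inr j := rfl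

theorem sumSwap_eq_comp_sumSwapPerm {p : ℕ} (S : Finset (Fin p)) :
    sumSwap S = fun x => x ∘ sumSwapPerm S := by
  funext x i
  rcases i with j | j <;> by_cases hj : j ∈ S <;>
    simp [sumSwap, sumSwapPerm_inl, sumSwapPerm_inr, hj]

theorem fromBlocks_submatrix_sumSwapPerm {p : ℕ} (Sg : Matrix (Fin p) (Fin p) ℝ)
    {D : Matrix (Fin p) (Fin p) ℝ} (hD : D.IsDiag) (S : Finset (Fin p)) :
    (fromBlocks Sg (Sg - D) (Sg - D) Sg).submatrix (sumSwapPerm S) (sumSwapPerm S) =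
      fromBlocks Sg (Sg - D) (Sg - D) Sg := by
  have hD_zero : ∀ j k, (j ∈ S ↔ k ∉ S) → D j k = 0 := fun j k h =>
    hD (by rintro rfl; tauto)
  ext i j
  rcases i with i | i <;> rcases j with j | j <;> by_cases hi : i ∈ S <;> by_cases hj : j ∈ S <;>
    simp [sumSwapPerm_inl, sumSwapPerm_inr, hi, hj, hD_zero i j]

/-- If `(X, X̃) ~ N(0, G)` with `G = [[Σ, Σ−D], [Σ−D, Σ]]`, `Σ` symmetric PSD, `D`
diagonal and `G` PSD, then the Gaussian law is invariant under every swap map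
`swap_S`; i.e. `X̃` satisfies the exchangeability condition of model-X knockoffs. -/
theorem gaussian_knockoff_swap_invariant
    {p : ℕ} (Sg D : Matrix (Fin p) (Fin p) ℝ)
    (hSgSymm : Sg.IsSymm) (hSgPSD : Sg.PosSemidef) (hD : D.IsDiag)
    (hG : (Matrix.fromBlocks Sg (Sg - D) (Sg - D) Sg).PosSemidef)
    (ν : Measure (Fin p ⊕ Fin p → ℝ))
    (hν : IsCenteredGaussianWithCov ν (Matrix.fromBlocks Sg (Sg - D) (Sg - D) Sg))
    (S : Finset (Fin p)) :
    ν.map (sumSwap S) = ν := by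
  rw [sumSwap_eq_comp_sumSwapPerm]
  exact hν.map_comp_perm _ (fromBlocks_submatrix_sumSwapPerm Sg hD S)
end

section
/- Fix p ∈ ℕ, a symmetric positive definite p×p real matrix Σ, and a diagonal p×p real matrix D = diag(s) such that 2D − D Σ⁻¹ D is positive definite. Let (X, X̃) be a random vector in ℝ^p × ℝ^p distributed as the centered Gaussian N(0, G) with G = [[Σ, Σ−D], [Σ−D, Σ]]. Then the conditional distribution of X̃ given X = x is, for almost every x, the multivariate Gaussian with mean (I − D Σ⁻¹) x and covariance matrix 2D − D Σ⁻¹ D. -/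
open MeasureTheory ProbabilityTheory Matrix

/-- `ν` is the multivariate Gaussian measure on `ℝ^p` with mean vector `m` and
covariance matrix `C`, characterized (Cramér–Wold) by its one-dimensional linear
marginals: for every `a`, the law of `x ↦ ∑ i, a i * x i` is `N(aᵀm, aᵀ C a)`. -/
def IsGaussianWith {n : Type*} [Fintype n]
    (ν : Measure (n → ℝ)) (m : n → ℝ) (C : Matrix n n ℝ) : Prop :=
  IsProbabilityMeasure ν ∧
    ∀ a : n → ℝ,
      ν.map (fun x => ∑ i, a i * x i) =
        gaussianReal (∑ i, a i * m i) (Real.toNNReal (a ⬝ᵥ C *ᵥ a))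

/-- If `X` and `Z` are independent, then conditionally on `X = x` the variable `f (X, Z)` has the
law of `f (x, Z)`. -/
theorem condDistrib_of_indepFun {Ω β γ δ : Type*} [MeasurableSpace Ω] [MeasurableSpace β]
    [MeasurableSpace γ] [MeasurableSpace δ] [StandardBorelSpace δ] [Nonempty δ]
    {P : Measure Ω} [IsProbabilityMeasure P] {X : Ω → β} {Z : Ω → γ}
    (hX : Measurable X) (hZ : Measurable Z) (hXZ : X ⟂ᵢ[P] Z)
    {f : β × γ → δ} (hf : Measurable f) :
    ∀ᵐ x ∂(P.map X), condDistrib (fun ω => f (X ω, Z ω)) X P x =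
      (P.map Z).map (fun z => f (x, z)) := by
  have := Measure.isProbabilityMeasure_map (μ := P) hX.aemeasurable
  have := Measure.isProbabilityMeasure_map (μ := P) hZ.aemeasurable
  let κ : Kernel β δ := (Kernel.id ×ₖ Kernel.const β (P.map Z)).map f
  have hκ_apply : ∀ x, κ x = (P.map Z).map (fun z => f (x, z)) := fun x => by
    rw [Kernel.map_apply _ hf, Kernel.prod_apply, Kernel.id_apply, Kernel.const_apply,
      Measure.dirac_prod, Measure.map_map hf (by fun_prop), Function.comp_def]
  have : IsMarkovKernel κ := Kernel.IsMarkovKernel.map _ hf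
  have hκ : P.map (fun ω => (X ω, f (X ω, Z ω))) = P.map X ⊗ₘ κ := by
    have hg : Measurable fun q : β × γ => (q.1, f q) := by fun_prop
    rw [show (fun ω => (X ω, f (X ω, Z ω))) = (fun q : β × γ => (q.1, f q)) ∘
        fun ω => (X ω, Z ω) from rfl, ← Measure.map_map hg (by fun_prop),
      (indepFun_iff_map_prod_eq_prod_map_map hX.aemeasurable hZ.aemeasurable).1 hXZ]
    ext s hs
    rw [Measure.map_apply hg hs, Measure.prod_apply (hg hs), Measure.compProd_apply hs]
    refine lintegral_congr fun x => ?_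
    rw [hκ_apply, Measure.map_apply (by fun_prop) (measurable_prodMk_left hs)]
    rfl
  filter_upwards [condDistrib_ae_eq_of_measure_eq_compProd X
    (hf.comp (hX.prodMk hZ)).aemeasurable hκ] with x hx
  exact hx.trans (hκ_apply x)

/-- A continuous linear form on `ℝⁿ` is the dot product with its values on the standard basis. -/
theorem strongDual_pi_apply_eq_dotProduct {n : Type*} [Fintype n] [DecidableEq n]
    (L : StrongDual ℝ (n → ℝ)) (x : n → ℝ) :
    L x = (fun i => L (Pi.single i 1)) ⬝ᵥ x := by
  conv_lhs => rw [pi_eq_sum_univ' x, map_sum]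
  simp [dotProduct, mul_comm]

/-- Two random vectors are independent as soon as the law of each linear combination of their
coordinates is centered Gaussian with variance the sum of a function of the first coefficient
vector and a function of the second one. -/
theorem indepFun_of_map_dotProduct_add_eq_gaussianReal {Ω m n : Type*} [MeasurableSpace Ω]
    [Fintype m] [Fintype n] {P : Measure Ω} [IsProbabilityMeasure P]
    {X : Ω → m → ℝ} {Z : Ω → n → ℝ} (hX : Measurable X) (hZ : Measurable Z)
    {q : (m → ℝ) → NNReal} {r : (n → ℝ) → NNReal} (hq : q 0 = 0) (hr : r 0 = 0)
    (h : ∀ u v, P.map (fun ω => u ⬝ᵥ X ω + v ⬝ᵥ Z ω) = gaussianReal 0 (q u + r v)) :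
    X ⟂ᵢ[P] Z := by
  classical
  rw [indepFun_iff_charFunDual_prod hX.aemeasurable hZ.aemeasurable]
  intro L
  set u : m → ℝ := fun i => L.comp (.inl ℝ (m → ℝ) (n → ℝ)) (Pi.single i 1)
  set v : n → ℝ := fun i => L.comp (.inr ℝ (m → ℝ) (n → ℝ)) (Pi.single i 1)
  have hLX : ∀ x, L.comp (.inl ℝ (m → ℝ) (n → ℝ)) x = u ⬝ᵥ x :=
    strongDual_pi_apply_eq_dotProduct _
  have hLZ : ∀ z, L.comp (.inr ℝ (m → ℝ) (n → ℝ)) z = v ⬝ᵥ z :=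
    strongDual_pi_apply_eq_dotProduct _
  have hL : ∀ x z, L (x, z) = u ⬝ᵥ x + v ⬝ᵥ z := fun x z => by
    rw [← hLX, ← hLZ]
    simp [← map_add]
  have hX' : P.map (fun ω => u ⬝ᵥ X ω) = gaussianReal 0 (q u) := by simpa [hr] using h u 0
  have hZ' : P.map (fun ω => v ⬝ᵥ Z ω) = gaussianReal 0 (r v) := by simpa [hq] using h 0 v
  rw [charFunDual_eq_charFun_map_one, charFunDual_eq_charFun_map_one,
    charFunDual_eq_charFun_map_one, Measure.map_map (by fun_prop) (by fun_prop),
    Measure.map_map (by fun_prop) (by fun_prop), Measure.map_map (by fun_prop) (by fun_prop)]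
  simp only [Function.comp_def, hL, hLX, hLZ]
  rw [h, hX', hZ', charFun_gaussianReal, charFun_gaussianReal, charFun_gaussianReal,
    ← Complex.exp_add]
  congr 1
  push_cast
  ring

/-- Completing the square in the quadratic form of the knockoff covariance matrix. -/
theorem knockoff_quadraticForm_eq {n : Type*} [Fintype n] [DecidableEq n] {Sg D : Matrix n n ℝ}
    (hSg : Sg.IsSymm) (hdet : IsUnit Sg.det) (hD : D.IsSymm) (u v : n → ℝ) :
    Sum.elim (u - (1 - D * Sg⁻¹)ᵀ *ᵥ v) v ⬝ᵥ
        Matrix.fromBlocks Sg (Sg - D) (Sg - D) Sg *ᵥ Sum.elim (u - (1 - D * Sg⁻¹)ᵀ *ᵥ v) v =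
      u ⬝ᵥ Sg *ᵥ u + v ⬝ᵥ ((2 : ℝ) • D - D * Sg⁻¹ * D) *ᵥ v := by
  set A := 1 - D * Sg⁻¹ with hA
  have hAS : A * Sg = Sg - D := by
    rw [hA, sub_mul, one_mul, mul_assoc, Matrix.nonsing_inv_mul _ hdet, mul_one]
  have hSA : Sg * Aᵀ = Sg - D := by
    simpa [Matrix.transpose_mul, hSg.eq, hD.eq] using congrArg Matrix.transpose hAS
  have hASA : (2 : ℝ) • D - D * Sg⁻¹ * D = Sg - A * (Sg * Aᵀ) := by
    rw [hSA, hA, mul_sub, sub_mul, sub_mul, mul_assoc D Sg⁻¹ Sg,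
      Matrix.nonsing_inv_mul _ hdet, two_smul]
    simp
    abel
  have hvA : ∀ w, v ⬝ᵥ A *ᵥ w = Aᵀ *ᵥ v ⬝ᵥ w := fun w => by
    rw [Matrix.dotProduct_mulVec, Matrix.mulVec_transpose]
  have hcomm : (Aᵀ *ᵥ v) ⬝ᵥ Sg *ᵥ u = u ⬝ᵥ Sg *ᵥ (Aᵀ *ᵥ v) := by
    rw [Matrix.dotProduct_mulVec, ← Matrix.mulVec_transpose, hSg.eq, dotProduct_comm]
  rw [Matrix.fromBlocks_mulVec, hASA]
  nth_rewrite 1 [← hSA]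
  rw [← hAS]
  simp only [Function.comp_def, Sum.elim_inl, Sum.elim_inr, sumElim_dotProduct_sumElim,
    Matrix.sub_mulVec, Matrix.mulVec_sub, dotProduct_add, dotProduct_sub, sub_dotProduct,
    ← Matrix.mulVec_mulVec, hvA, hcomm]
  ring

/-- If `(X, X̃)` is jointly centered Gaussian with the knockoff covariance matrix
`G = [[Σ, Σ−D], [Σ−D, Σ]]` (Σ symmetric positive definite, `D = diag(s)` diagonal
with `2D − DΣ⁻¹D` positive definite), then for almost every `x` the conditional
distribution of `X̃` given `X = x` is Gaussian with mean `(I − DΣ⁻¹)x` and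
covariance `2D − DΣ⁻¹D`. -/
theorem condDistrib_knockoff_gaussian
    {Ω : Type*} [MeasurableSpace Ω] [StandardBorelSpace Ω]
    (P : Measure Ω) [IsProbabilityMeasure P]
    {p : ℕ} (Sg D : Matrix (Fin p) (Fin p) ℝ)
    (hSgSymm : Sg.IsSymm) (hSgPD : Sg.PosDef) (hD : D.IsDiag)
    (hSchur : ((2 : ℝ) • D - D * Sg⁻¹ * D).PosDef)
    (X Xt : Ω → (Fin p → ℝ)) (hX : Measurable X) (hXt : Measurable Xt)
    (hjoint : IsGaussianWith
      (P.map (fun ω => Sum.elim (X ω) (Xt ω)))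
      (fun _ => 0) (Matrix.fromBlocks Sg (Sg - D) (Sg - D) Sg)) :
    ∀ᵐ x ∂(P.map X),
      IsGaussianWith (condDistrib Xt X P x)
        ((1 - D * Sg⁻¹) *ᵥ x) ((2 : ℝ) • D - D * Sg⁻¹ * D) := by
  set C := (2 : ℝ) • D - D * Sg⁻¹ * D
  set A := 1 - D * Sg⁻¹
  set Z : Ω → Fin p → ℝ := fun ω => Xt ω - A *ᵥ X ω with hZdef
  have hA_meas : Measurable fun x : Fin p → ℝ => A *ᵥ x :=
    (Matrix.mulVecLin A).continuous_of_finiteDimensional.measurable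
  have hZ : Measurable Z := hXt.sub (hA_meas.comp hX)
  have hlaw : ∀ u v : Fin p → ℝ, P.map (fun ω => u ⬝ᵥ X ω + v ⬝ᵥ Z ω) =
      gaussianReal 0 ((u ⬝ᵥ Sg *ᵥ u).toNNReal + (v ⬝ᵥ C *ᵥ v).toNNReal) := fun u v => by
    have h := hjoint.2 (Sum.elim (u - Aᵀ *ᵥ v) v)
    rw [knockoff_quadraticForm_eq hSgSymm hSgPD.det_pos.ne'.isUnit hD.isSymm,
      Measure.map_map (by fun_prop) (measurable_pi_iff.2 fun i => by
        cases i <;> simp only [Sum.elim_inl, Sum.elim_inr] <;> fun_prop),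
      Real.toNNReal_add (by simpa using hSgPD.posSemidef.dotProduct_mulVec_nonneg u)
        (by simpa using hSchur.posSemidef.dotProduct_mulVec_nonneg v)] at h
    simp only [mul_zero, Finset.sum_const_zero] at h
    rw [← h]
    congr 1
    funext ω
    have : ∑ i, Sum.elim (u - Aᵀ *ᵥ v) v i * Sum.elim (X ω) (Xt ω) i =
        (u - Aᵀ *ᵥ v) ⬝ᵥ X ω + v ⬝ᵥ Xt ω := by simp [dotProduct]
    rw [Function.comp_apply, this, hZdef, dotProduct_sub, sub_dotProduct,
      Matrix.dotProduct_mulVec v A, Matrix.mulVec_transpose]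
    ring
  have hXZ : X ⟂ᵢ[P] Z := indepFun_of_map_dotProduct_add_eq_gaussianReal hX hZ
    (q := fun u => (u ⬝ᵥ Sg *ᵥ u).toNNReal) (r := fun v => (v ⬝ᵥ C *ᵥ v).toNNReal)
    (by simp) (by simp) hlaw
  have hf : Measurable fun q : (Fin p → ℝ) × (Fin p → ℝ) => A *ᵥ q.1 + q.2 :=
    (hA_meas.comp measurable_fst).add measurable_snd
  have hXt_eq : (fun ω => A *ᵥ X ω + Z ω) = Xt := by
    funext ω
    simp [hZdef]
  have hcond := condDistrib_of_indepFun hX hZ hXZ hf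
  simp only [hXt_eq] at hcond
  filter_upwards [hcond] with x hx
  refine ⟨inferInstance, fun a => ?_⟩
  have hZa : P.map (fun ω => a ⬝ᵥ Z ω) = gaussianReal 0 (a ⬝ᵥ C *ᵥ a).toNNReal := by
    simpa using hlaw 0 a
  have hcomp : ((fun y : Fin p → ℝ => ∑ i, a i * y i) ∘ fun z => A *ᵥ x + z) ∘ Z =
      (fun t => a ⬝ᵥ A *ᵥ x + t) ∘ fun ω => a ⬝ᵥ Z ω := by
    funext ω
    simp [dotProduct, mul_add, Finset.sum_add_distrib]
  rw [hx, Measure.map_map (by fun_prop) (by fun_prop), Measure.map_map (by fun_prop) hZ, hcomp,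
    ← Measure.map_map (by fun_prop) (by unfold dotProduct; fun_prop), hZa,
    gaussianReal_map_const_add, zero_add]
  rfl
end
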